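/- For every integer k ≥ 1 and every real number t ≠ 0, 1/(1 - e^{-t})^k = 1 + ∑_{i=1}^{k} a_{k,i-1} · f^{(i-1)}(t), where f^{(i-1)}(t) denotes the (i-1)-th derivative at t of the function f(t) = 1/(e^t - 1), and where the rational coefficients a_{k,i-1} are given by the determinant formula a_{k,i-1} = (-1)^{i+1} · det M(k,i). -/

import Mathlib

/-- The Stirling numbers of the second kind, via the explicit formula. -/
def S (n m : ℕ) : ℚ :=
  (1 / (m.factorial : ℚ)) *
    ∑ ℓ ∈ Finset.range (m + 1), (-1 : ℚ) ^ (m - ℓ) * (m.choose ℓ : ℚ) * (ℓ : ℚ) ^ n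

/-- The `(k-i+1) × (k-i+1)` matrix `M(k,i)`: for `r c : Fin (k-i+1)` (zero-indexed, so the
row is `r+1` and the column `c+1` in the one-indexed description), the first-column entry
is `(1/(i+r-1)!) ⬝ C(k, i+r)` and the entry in a later column `c` is `S(i+c, i+r)`. -/
def M (k i : ℕ) : Matrix (Fin (k - i + 1)) (Fin (k - i + 1)) ℚ := fun r c =>
  if c.val = 0 then (1 / ((i + r.val - 1).factorial : ℚ)) * (k.choose (i + r.val) : ℚ)
  else S (i + c.val) (i + r.val)

/-- The coefficient `a_{k,i-1} = (-1)^{i+1} det M(k,i)`; here `a k i` stands for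
the quantity denoted `a_{k,i-1}` (so `i` runs from `1` to `k`). -/
def a (k i : ℕ) : ℚ := (-1 : ℚ) ^ (i + 1) * (M k i).det

lemma S_zero_left (m : ℕ) : S 0 m = (Nat.stirlingSecond 0 m : ℚ) := by
  have h := add_pow (1 : ℚ) (-1) m
  have h2 : ∑ l ∈ Finset.range (m + 1), (-1 : ℚ) ^ (m - l) * (m.choose l : ℚ) * (l : ℚ) ^ 0
      = (1 + -1 : ℚ) ^ m := by
    rw [h]
    apply Finset.sum_congr rfl
    intro l _
    simp
  unfold S
  rw [h2]
  cases m <;> simp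

lemma S_succ_zero (n : ℕ) : S (n + 1) 0 = 0 := by
  simp [S]

lemma S_succ_succ (n m : ℕ) : S (n + 1) (m + 1) = (m + 1) * S n (m + 1) + S n m := by
  unfold S
  have key : ∑ l ∈ Finset.range (m + 1 + 1),
      (-1 : ℚ) ^ (m + 1 - l) * ((m + 1).choose l : ℚ) * (l : ℚ) ^ (n + 1)
      = (m + 1) * (∑ l ∈ Finset.range (m + 1 + 1),
      (-1 : ℚ) ^ (m + 1 - l) * ((m + 1).choose l : ℚ) * (l : ℚ) ^ n
      + ∑ l ∈ Finset.range (m + 1), (-1 : ℚ) ^ (m - l) * (m.choose l : ℚ) * (l : ℚ) ^ n) := by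
    rw [Finset.sum_range_succ _ (m + 1), Finset.sum_range_succ _ (m + 1)]
    have : ∑ l ∈ Finset.range (m + 1),
      (-1 : ℚ) ^ (m + 1 - l) * ((m + 1).choose l : ℚ) * (l : ℚ) ^ (n + 1)
      = (m + 1) * (∑ l ∈ Finset.range (m + 1),
      (-1 : ℚ) ^ (m + 1 - l) * ((m + 1).choose l : ℚ) * (l : ℚ) ^ n
      + ∑ l ∈ Finset.range (m + 1), (-1 : ℚ) ^ (m - l) * (m.choose l : ℚ) * (l : ℚ) ^ n) := by
      rw [← Finset.sum_add_distrib, Finset.mul_sum]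
      apply Finset.sum_congr rfl
      intro l hl
      have hl' : l ≤ m := by simpa [Nat.lt_succ_iff] using hl
      have e : m + 1 - l = (m - l) + 1 := by omega
      rw [e, pow_succ (-1 : ℚ)]
      have hc : ((l : ℚ)) * ((m + 1).choose l : ℚ)
          = (m + 1) * (((m + 1).choose l : ℚ) - (m.choose l : ℚ)) := by
        cases l with
        | zero => simp
        | succ l =>
          have h1 := Nat.add_one_mul_choose_eq m l
          have h2 := Nat.choose_succ_succ m l
          have h1' : ((m : ℚ) + 1) * (m.choose l : ℚ)
            = ((m + 1).choose (l + 1) : ℚ) * (l + 1) := by exact_mod_cast h1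
          have h2' : ((m + 1).choose (l + 1) : ℚ) = m.choose l + m.choose (l + 1) := by
            exact_mod_cast h2
          rw [h2'] at h1' ⊢
          push_cast
          linarith
      linear_combination (-(-1 : ℚ) ^ (m - l) * (l : ℚ) ^ n) * hc
    rw [this]
    simp
    ring
  rw [key, Nat.factorial_succ]
  have : (m.factorial : ℚ) ≠ 0 := by positivity
  have : (m + 1 : ℚ) ≠ 0 := by positivity
  push_cast
  field_simp

lemma S_eq (n m : ℕ) : S n m = (Nat.stirlingSecond n m : ℚ) := by
  induction n generalizing m with
  | zero => exact S_zero_left m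
  | succ n ih =>
    cases m with
    | zero => simp [S_succ_zero]
    | succ m => rw [S_succ_succ, ih, ih, Nat.stirlingSecond_succ_succ]; push_cast; ring

lemma S_lt {n m : ℕ} (h : n < m) : S n m = 0 := by
  rw [S_eq, Nat.stirlingSecond_eq_zero_of_lt h]; simp

lemma S_self (n : ℕ) : S n n = 1 := by
  rw [S_eq, Nat.stirlingSecond_self]; simp

lemma exists_sol (k : ℕ) (v : ℕ → ℚ) : ∃ b : ℕ → ℚ, ∀ m, m < k →
    ∑ i ∈ Finset.range k, b i * S (i + 1) (m + 1) = v m := by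
  induction k generalizing v with
  | zero => exact ⟨0, by simp⟩
  | succ k ih =>
    obtain ⟨b, hb⟩ := ih (fun m => v m - v k * S (k + 1) (m + 1))
    refine ⟨fun i => if i = k then v k else b i, fun m hm => ?_⟩
    rw [Finset.sum_range_succ]
    have : ∑ i ∈ Finset.range k, (if i = k then v k else b i) * S (i + 1) (m + 1)
        = ∑ i ∈ Finset.range k, b i * S (i + 1) (m + 1) := by
      apply Finset.sum_congr rfl
      intro i hi
      rw [if_neg (by simp at hi; omega)]
    rw [this]
    by_cases hmk : m = k
    · subst hmk
      rw [Finset.sum_eq_zero]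
      · simp [S_self]
      · intro i hi
        rw [S_lt (by simp at hi; omega), mul_zero]
    · rw [hb m (by omega)]
      simp

lemma det_M_eq (k p : ℕ) (hp : p < k) (b : ℕ → ℚ)
    (hb : ∀ m, m < k → ∑ i ∈ Finset.range k, b i * S (i + 1) (m + 1)
      = (1 / (m.factorial : ℚ)) * (k.choose (m + 1) : ℚ)) :
    (M k (p + 1)).det = b p := by
  let A : Matrix (Fin (k - (p + 1) + 1)) (Fin (k - (p + 1) + 1)) ℚ :=
    fun r c => S (p + 1 + c.val) (p + 1 + r.val)
  let x : Fin (k - (p + 1) + 1) → ℚ := fun c => b (p + c.val)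
  have hdet : A.det = 1 := by
    rw [Matrix.det_of_isUpperTriangular]
    · apply Finset.prod_eq_one
      intro i _
      exact S_self _
    · intro r c hrc
      exact S_lt (by have : c.val < r.val := hrc; omega)
  have hM : M k (p + 1) = A.updateCol 0 (A.mulVec x) := by
    ext r c
    rw [Matrix.updateCol_apply]
    by_cases hc : c = 0
    · subst hc
      have h := hb (p + r.val) (by omega)
      simp only [M, Fin.val_zero, if_true, Matrix.mulVec, dotProduct, A, x]
      rw [Fin.sum_univ_eq_sum_range
        (fun j => S (p + 1 + j) (p + 1 + r.val) * b (p + j)) (k - (p + 1) + 1)]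
      have hk : k = p + (k - (p + 1) + 1) := by omega
      have e : p + 1 + r.val - 1 = p + r.val := by omega
      have e' : p + 1 + r.val = p + r.val + 1 := by omega
      rw [e, e', ← h]
      rw [show Finset.range k = Finset.range (p + (k - (p + 1) + 1)) from congrArg _ hk]
      rw [Finset.sum_range_add, Finset.sum_eq_zero, zero_add]
      · apply Finset.sum_congr rfl
        intro j _
        rw [mul_comm]
        congr 2
        omega
      · intro i hi
        rw [S_lt (by simp at hi; omega), mul_zero]
    · have : c.val ≠ 0 := fun h => hc (Fin.ext h)
      simp [M, this, hc, A]
  rw [hM, ← Matrix.cramer_apply, Matrix.cramer_eq_adjugate_mulVec, Matrix.mulVec_mulVec,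
    Matrix.adjugate_mul, hdet]
  simp [x]

lemma iter_f (n : ℕ) : ∀ t : ℝ, t ≠ 0 →
    iteratedDeriv n (fun s : ℝ => 1 / (Real.exp s - 1)) t =
      (-1) ^ n * ∑ m ∈ Finset.range (n + 1),
        (m.factorial : ℝ) * (Nat.stirlingSecond (n + 1) (m + 1) : ℝ)
          * (1 / (Real.exp t - 1)) ^ (m + 1) := by
  induction n with
  | zero => intro t ht; simp [Nat.stirlingSecond]
  | succ n ih =>
    intro t ht
    have he : Real.exp t - 1 ≠ 0 := by
      rw [sub_ne_zero]; simpa using ht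
    rw [iteratedDeriv_succ]
    have hev : iteratedDeriv n (fun s : ℝ => 1 / (Real.exp s - 1)) =ᶠ[nhds t]
      fun t => (-1) ^ n * ∑ m ∈ Finset.range (n + 1),
        (m.factorial : ℝ) * (Nat.stirlingSecond (n + 1) (m + 1) : ℝ)
          * (1 / (Real.exp t - 1)) ^ (m + 1) := by
      filter_upwards [isOpen_ne.mem_nhds ht] with s hs using ih s hs
    rw [hev.deriv_eq]
    set f : ℝ := 1 / (Real.exp t - 1) with hf
    have hd : HasDerivAt (fun s : ℝ => 1 / (Real.exp s - 1)) (-(f * (1 + f))) t := by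
      have h := ((Real.hasDerivAt_exp t).sub_const 1).inv he
      simp only [one_div]
      refine h.congr_deriv ?_
      rw [hf]
      field_simp
      ring
    have hs : HasDerivAt (fun t : ℝ => (-1) ^ n * ∑ m ∈ Finset.range (n + 1),
        (m.factorial : ℝ) * (Nat.stirlingSecond (n + 1) (m + 1) : ℝ)
          * (1 / (Real.exp t - 1)) ^ (m + 1))
        ((-1) ^ n * ∑ m ∈ Finset.range (n + 1),
        (m.factorial : ℝ) * (Nat.stirlingSecond (n + 1) (m + 1) : ℝ)
          * (((m + 1 : ℕ) : ℝ) * f ^ m * (-(f * (1 + f))))) t := by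
      apply HasDerivAt.const_mul
      apply HasDerivAt.fun_sum
      intro m _
      apply HasDerivAt.const_mul
      exact hd.fun_pow (m + 1)
    rw [hs.deriv, pow_succ, mul_assoc]
    congr 1
    have h1 : ∀ m : ℕ, (m.factorial : ℝ) * (Nat.stirlingSecond (n + 1 + 1) (m + 1) : ℝ)
        * f ^ (m + 1)
        = (m.factorial : ℝ) * (m + 1) * (Nat.stirlingSecond (n + 1) (m + 1) : ℝ) * f ^ (m + 1)
        + (m.factorial : ℝ) * (Nat.stirlingSecond (n + 1) m : ℝ) * f ^ (m + 1) := by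
      intro m
      rw [Nat.stirlingSecond_succ_succ (n + 1) m]
      push_cast
      ring
    simp only [h1]
    rw [Finset.sum_add_distrib, Finset.sum_range_succ _ (n + 1),
      Nat.stirlingSecond_eq_zero_of_lt (by omega : n + 1 < n + 1 + 1),
      Finset.sum_range_succ' _ (n + 1), Nat.stirlingSecond_succ_zero]
    simp only [Nat.cast_zero, mul_zero, zero_mul, add_zero]
    rw [← Finset.sum_add_distrib, Finset.mul_sum]
    apply Finset.sum_congr rfl
    intro m _
    rw [Nat.factorial_succ]
    push_cast
    ring

theorem one_div_one_sub_exp_neg_pow_eq (k : ℕ) (hk : 1 ≤ k) (t : ℝ) (ht : t ≠ 0) :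
    1 / (1 - Real.exp (-t)) ^ k =
      1 + ∑ i ∈ Finset.Icc 1 k,
        (a k i : ℝ) * iteratedDeriv (i - 1) (fun s : ℝ => 1 / (Real.exp s - 1)) t := by
  obtain ⟨b, hb⟩ := exists_sol k (fun m => (1 / (m.factorial : ℚ)) * (k.choose (m + 1) : ℚ))
  have he : Real.exp t - 1 ≠ 0 := by
    rw [sub_ne_zero]; simpa using ht
  have hI : ∑ i ∈ Finset.Icc 1 k,
        (a k i : ℝ) * iteratedDeriv (i - 1) (fun s : ℝ => 1 / (Real.exp s - 1)) t
      = ∑ i ∈ Finset.range k,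
        (a k (i + 1) : ℝ) * iteratedDeriv i (fun s : ℝ => 1 / (Real.exp s - 1)) t := by
    rw [Finset.range_eq_Ico]
    exact (Finset.sum_Ico_add' (fun i => (a k i : ℝ) *
      iteratedDeriv (i - 1) (fun s : ℝ => 1 / (Real.exp s - 1)) t) 0 k 1).symm
  rw [hI]
  set f : ℝ := 1 / (Real.exp t - 1) with hf
  have hL : 1 / (1 - Real.exp (-t)) ^ k = (f + 1) ^ k := by
    rw [← one_div_pow]
    congr 1
    rw [hf, Real.exp_neg]
    have := Real.exp_ne_zero t
    have h2 : 1 - (Real.exp t)⁻¹ ≠ 0 := by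
      intro h
      apply he
      field_simp at h
      simpa using h
    field_simp
    ring
  have hterm : ∀ i ∈ Finset.range k,
      (a k (i + 1) : ℝ) * iteratedDeriv i (fun s : ℝ => 1 / (Real.exp s - 1)) t
      = ∑ m ∈ Finset.range k, ((b i * S (i + 1) (m + 1) : ℚ) : ℝ) *
          ((m.factorial : ℝ) * f ^ (m + 1)) := by
    intro i hi
    have hi' : i < k := by simpa using hi
    rw [iter_f i t ht, a, det_M_eq k i hi' b hb]
    have hsub : ∑ m ∈ Finset.range (i + 1),
        (m.factorial : ℝ) * (Nat.stirlingSecond (i + 1) (m + 1) : ℝ) * f ^ (m + 1)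
        = ∑ m ∈ Finset.range k,
        (m.factorial : ℝ) * (Nat.stirlingSecond (i + 1) (m + 1) : ℝ) * f ^ (m + 1) := by
      apply Finset.sum_subset
      · intro j hj
        simp at hj ⊢
        omega
      · intro m _ hm
        rw [Nat.stirlingSecond_eq_zero_of_lt (by simp at hm; omega)]
        simp
    rw [← hf, hsub, Finset.mul_sum, Finset.mul_sum]
    apply Finset.sum_congr rfl
    intro m _
    rw [S_eq]
    push_cast
    have hs : ((-1 : ℝ) ^ i) * (-1) ^ i = 1 := by
      rw [← mul_pow]; simp
    linear_combination ((b i : ℝ) * (m.factorial : ℝ)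
      * (Nat.stirlingSecond (i + 1) (m + 1) : ℝ) * f ^ (m + 1)) * hs
  rw [Finset.sum_congr rfl hterm, Finset.sum_comm, hL, add_pow, Finset.sum_range_succ', add_comm]
  congr 1
  · simp
  · apply Finset.sum_congr rfl
    intro m hm
    rw [← Finset.sum_mul, ← Rat.cast_sum, hb m (by simpa using hm)]
    have : (m.factorial : ℝ) ≠ 0 := by positivity
    push_cast
    field_simp
    simp
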